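/- Let l ≥ 4 be an integer, let G ∈ 𝒢_l and let C be an odd hole of G. For i = 1, 2 let P_i be a short or local (u_i, v_i)-jump over C such that {u1, v1} ≠ {u2, v2} and u1, u2, v2, v1 appear on C in clockwise order; assume P1 is across C*(v1, u1), P2 is across C*(u2, v2), and whenever P_i is local it is across one vertex. If both P1 and P2 are short jumps, then G contains an odd K4-subdivision. -/

import Mathlib

open SimpleGraph

variable {V : Type*}

/-- The set of internal vertices of a walk from `x` to `y`. -/
def wInterior {G : SimpleGraph V} {x y : V} (P : G.Walk x y) : Set V :=
  {a | a ∈ P.support ∧ a ≠ x ∧ a ≠ y}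

/-- `P` is an induced path of `G`. -/
def IsInducedPath (G : SimpleGraph V) {x y : V} (P : G.Walk x y) : Prop :=
  P.IsPath ∧ ∀ a ∈ P.support, ∀ b ∈ P.support, G.Adj a b → s(a, b) ∈ P.edges

/-- A hole of `G`: an induced cycle of length at least 4. -/
def IsHole (G : SimpleGraph V) {v : V} (w : G.Walk v v) : Prop :=
  w.IsCycle ∧ 4 ≤ w.length ∧
    ∀ a ∈ w.support, ∀ b ∈ w.support, G.Adj a b → s(a, b) ∈ w.edges

/-- An odd hole of `G`. -/
def IsOddHole (G : SimpleGraph V) {v : V} (w : G.Walk v v) : Prop :=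
  IsHole G w ∧ Odd w.length

/-- `G` belongs to the family `𝒢ₗ`: it has girth `2l+1` and
no odd hole of length at least `2l+3`. -/
def MemGFam (G : SimpleGraph V) (l : ℕ) : Prop :=
  G.girth = (2 * l + 1 : ℕ) ∧
    ∀ (v : V) (w : G.Walk v v), IsOddHole G w → w.length < 2 * l + 3

/-- `G` is `k`-vertex-critical. -/
def IsVertexCritical (G : SimpleGraph V) (k : ℕ) : Prop :=
  G.chromaticNumber = k ∧
    ∀ v : V, (G.induce {u | u ≠ v}).chromaticNumber < k

/-- `S` is a vertex cut of `G`: deleting `S` leaves a disconnected graph. -/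
def IsVertexCut (G : SimpleGraph V) (S : Set V) : Prop :=
  ¬ (G.induce Sᶜ).Preconnected

/-- `G` has a `K2`-cut. -/
def HasK2Cut (G : SimpleGraph V) : Prop :=
  ∃ u v : V, G.Adj u v ∧ IsVertexCut G {u, v}

/-- `G` has a `P3`-cut. -/
def HasP3Cut (G : SimpleGraph V) : Prop :=
  ∃ u v w : V, u ≠ w ∧ G.Adj u v ∧ G.Adj v w ∧ ¬ G.Adj u w ∧ IsVertexCut G {u, v, w}

/-- `G` has a 2-edge-cut: two edges whose removal disconnects the graph. -/
def Has2EdgeCut (G : SimpleGraph V) : Prop :=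
  ∃ e f : Sym2 V, e ≠ f ∧ e ∈ G.edgeSet ∧ f ∈ G.edgeSet ∧
    ¬ (G.deleteEdges {e, f}).Preconnected

/-- `Q1`, `Q2` are the two internally disjoint `(x,y)`-paths of the cycle `w`. -/
def ArcsOf (G : SimpleGraph V) {v x y : V} (w : G.Walk v v) (Q1 Q2 : G.Walk x y) : Prop :=
  x ∈ w.support ∧ y ∈ w.support ∧ x ≠ y ∧ Q1.IsPath ∧ Q2.IsPath ∧
    ({a | a ∈ Q1.support} ∩ {a | a ∈ Q2.support} = {x, y}) ∧
    ({e | e ∈ w.edges} = {e | e ∈ Q1.edges} ∪ {e | e ∈ Q2.edges})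

/-- `P` is a chordal path of the hole `w`: `w ∪ P` is an induced theta-subgraph of `G`. -/
def IsChordalPath (G : SimpleGraph V) {v x y : V} (w : G.Walk v v) (P : G.Walk x y) : Prop :=
  IsHole G w ∧ P.IsPath ∧ 2 ≤ P.length ∧ x ∈ w.support ∧ y ∈ w.support ∧ x ≠ y ∧
    (∀ a ∈ wInterior P, a ∉ w.support) ∧
    (∀ a, (a ∈ w.support ∨ a ∈ P.support) → ∀ b, (b ∈ w.support ∨ b ∈ P.support) →
      G.Adj a b → (s(a, b) ∈ w.edges ∨ s(a, b) ∈ P.edges))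

/-- `P` is an `(s,t)`-jump over the hole `w`. -/
def IsJump (G : SimpleGraph V) {v s t : V} (w : G.Walk v v) (P : G.Walk s t) : Prop :=
  IsHole G w ∧ s ∈ w.support ∧ t ∈ w.support ∧ s ≠ t ∧ ¬ G.Adj s t ∧
    IsInducedPath G P ∧ ∀ a ∈ wInterior P, a ∉ w.support

/-- `P` is a local jump over `w` across the interior of the arc `Q1`
(`Q1`, `Q2` being the two arcs of `w` between the ends of `P`). -/
def IsLocalJumpAcross (G : SimpleGraph V) {v s t : V} (w : G.Walk v v)
    (P Q1 Q2 : G.Walk s t) : Prop :=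
  IsJump G w P ∧ ArcsOf G w Q1 Q2 ∧
    (∃ a ∈ wInterior Q1, ∃ b ∈ wInterior P, G.Adj a b) ∧
    (∀ a ∈ wInterior Q2, ∀ b ∈ wInterior P, ¬ G.Adj a b)

/-- `P` is a local jump over `w`. -/
def IsLocalJump (G : SimpleGraph V) {v s t : V} (w : G.Walk v v) (P : G.Walk s t) : Prop :=
  ∃ Q1 Q2 : G.Walk s t, IsLocalJumpAcross G w P Q1 Q2

/-- `P` is a local jump over `w` across one vertex. -/
def IsLocalJumpAcrossOne (G : SimpleGraph V) {v s t : V} (w : G.Walk v v)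
    (P : G.Walk s t) : Prop :=
  ∃ Q1 Q2 : G.Walk s t, IsLocalJumpAcross G w P Q1 Q2 ∧ Q1.length = 2

/-- `P` is a short jump over `w`: no internal vertex of either arc of `w`
has a neighbour among the internal vertices of `P`. -/
def IsShortJump (G : SimpleGraph V) {v s t : V} (w : G.Walk v v) (P : G.Walk s t) : Prop :=
  IsJump G w P ∧
    ∀ a ∈ w.support, a ≠ s → a ≠ t → ∀ b ∈ wInterior P, ¬ G.Adj a b

/-- `P` is a short jump over `w` across the interior of `Q1`, i.e. `P ∪ Q1` is an
odd hole (a jump hole over `w`). -/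
def IsShortJumpAcross (G : SimpleGraph V) {v s t : V} (w : G.Walk v v)
    (P Q1 Q2 : G.Walk s t) : Prop :=
  IsShortJump G w P ∧ ArcsOf G w Q1 Q2 ∧ IsOddHole G (P.append Q1.reverse)

/-- `x` lies in some jump hole over `w`. -/
def InJumpHoleOver (G : SimpleGraph V) {v : V} (w : G.Walk v v) (x : V) : Prop :=
  ∃ (s t : V) (P Q1 Q2 : G.Walk s t),
    IsShortJumpAcross G w P Q1 Q2 ∧ (x ∈ P.support ∨ x ∈ Q1.support)

/-- `a`, `b`, `c`, `d` appear on the cycle `w` in this cyclic order. -/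
def CyclicOrder4 (G : SimpleGraph V) {v : V} (w : G.Walk v v) (a b c d : V) : Prop :=
  ∃ n : ℕ, List.Sublist [a, b, c, d] (w.support.tail.rotate n)

/-- A `K4`-subdivision in `G`: four distinct branch vertices joined by six
internally disjoint paths (the arrises). -/
structure K4Sub (G : SimpleGraph V) where
  u1 : V
  u2 : V
  u3 : V
  u4 : V
  P1 : G.Walk u1 u2
  P2 : G.Walk u3 u4
  Q1 : G.Walk u2 u3
  Q2 : G.Walk u1 u4
  L1 : G.Walk u1 u3
  L2 : G.Walk u2 u4
  hu : List.Nodup [u1, u2, u3, u4]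
  hP1 : P1.IsPath
  hP2 : P2.IsPath
  hQ1 : Q1.IsPath
  hQ2 : Q2.IsPath
  hL1 : L1.IsPath
  hL2 : L2.IsPath
  hP : ∀ a ∈ P1.support, a ∉ P2.support
  hQ : ∀ a ∈ Q1.support, a ∉ Q2.support
  hL : ∀ a ∈ L1.support, a ∉ L2.support

namespace K4Sub

variable {G : SimpleGraph V}

/-- The face cycle `C1 = P1 ∪ Q1 ∪ L1`. -/
def C1 (H : K4Sub G) : G.Walk H.u1 H.u1 := (H.P1.append H.Q1).append H.L1.reverse
/-- The face cycle `C2 = P1 ∪ Q2 ∪ L2`. -/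
def C2 (H : K4Sub G) : G.Walk H.u1 H.u1 := (H.P1.append H.L2).append H.Q2.reverse
/-- The face cycle `C3 = P2 ∪ Q1 ∪ L2`. -/
def C3 (H : K4Sub G) : G.Walk H.u2 H.u2 := (H.Q1.append H.P2).append H.L2.reverse
/-- The face cycle `C4 = C1 △ C2 △ C3 = P2 ∪ Q2 ∪ L1`. -/
def C4 (H : K4Sub G) : G.Walk H.u1 H.u1 := (H.L1.append H.P2).append H.Q2.reverse

/-- The vertex set of the subdivision. -/
def verts (H : K4Sub G) : Set V :=
  {a | a ∈ H.P1.support ∨ a ∈ H.P2.support ∨ a ∈ H.Q1.support ∨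
       a ∈ H.Q2.support ∨ a ∈ H.L1.support ∨ a ∈ H.L2.support}

/-- The edge set of the subdivision. -/
def edges (H : K4Sub G) : Set (Sym2 V) :=
  {e | e ∈ H.P1.edges ∨ e ∈ H.P2.edges ∨ e ∈ H.Q1.edges ∨
       e ∈ H.Q2.edges ∨ e ∈ H.L1.edges ∨ e ∈ H.L2.edges}

end K4Sub

/-- `H` is an odd `K4`-subdivision: all four face cycles are odd holes. -/
def IsOddK4 (G : SimpleGraph V) (H : K4Sub G) : Prop :=
  IsOddHole G H.C1 ∧ IsOddHole G H.C2 ∧ IsOddHole G H.C3 ∧ IsOddHole G H.C4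

/-- `G` has an odd `K4`-subdivision. -/
def HasOddK4 (G : SimpleGraph V) : Prop := ∃ H : K4Sub G, IsOddK4 G H

/-- `H` is a balanced `K4`-subdivision of type `(1,2)`. -/
def IsBalancedK4 (G : SimpleGraph V) (H : K4Sub G) : Prop :=
  IsOddHole G H.C1 ∧ IsOddHole G H.C2 ∧
    IsHole G H.C3 ∧ Even H.C3.length ∧ IsHole G H.C4 ∧ Even H.C4.length ∧
    H.Q1.length = 1 ∧ 2 ≤ H.L2.length

/-- `G` contains a balanced `K4`-subdivision of type `(1,2)`. -/
def HasBalancedK4 (G : SimpleGraph V) : Prop := ∃ H : K4Sub G, IsBalancedK4 G H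

/-- `P` is a direct connection linking the (vertex sets of) two disjoint induced
subgraphs `S1` and `S2`. -/
def IsDirectConnection (G : SimpleGraph V) (S1 S2 : Set V) {v1 v2 : V}
    (P : G.Walk v1 v2) : Prop :=
  IsInducedPath G P ∧ (∀ x ∈ P.support, x ∉ S1 ∧ x ∉ S2) ∧
    (∃ y ∈ S1, G.Adj v1 y) ∧ (∃ y ∈ S2, G.Adj v2 y) ∧
    (∀ x ∈ P.support, (∃ y ∈ S1, G.Adj x y) → x = v1) ∧
    (∀ x ∈ P.support, (∃ y ∈ S2, G.Adj x y) → x = v2)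

/-- `P` is a minimal direct connection linking `S1` and `S2`. -/
def IsMinimalDirectConnection (G : SimpleGraph V) (S1 S2 : Set V) {v1 v2 : V}
    (P : G.Walk v1 v2) : Prop :=
  IsDirectConnection G S1 S2 P ∧
    ∀ (w1 w2 : V) (P' : G.Walk w1 w2), IsDirectConnection G S1 S2 P' →
      (∀ x ∈ P'.support, x ∈ P.support) → ∀ x ∈ P.support, x ∈ P'.support

namespace SimpleGraph.Walk

variable {G : SimpleGraph V}

lemma IsPath.append_of_inter {u v w : V} {p : G.Walk u v} {q : G.Walk v w} (hp : p.IsPath)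
    (hq : q.IsPath) (h : ∀ a ∈ p.support, a ∈ q.support → a = v) : (p.append q).IsPath := by
  rw [isPath_def, support_append, List.nodup_append']
  refine ⟨hp.support_nodup, hq.support_nodup.tail, fun a ha hb => ?_⟩
  obtain rfl := h a ha (List.mem_of_mem_tail hb)
  have := hq.support_nodup
  rw [← cons_tail_support] at this
  exact (List.nodup_cons.1 this).1 hb

lemma IsPath.eq_of_mem_append {u v w a : V} {p : G.Walk u v} {q : G.Walk v w}
    (h : (p.append q).IsPath) (hp : a ∈ p.support) (hq : a ∈ q.support) : a = v := by
  by_contra hne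
  exact h.ne_of_mem_support_of_append hne hp hq rfl

lemma IsPath.length_add_length_ge_of_ne {n : ℕ}
    (hn : ∀ (v : V) (c : G.Walk v v), c.IsCycle → n ≤ c.length)
    {u v : V} {p q : G.Walk u v} (hp : p.IsPath) (hq : q.IsPath) (h : p ≠ q) :
    n ≤ p.length + q.length := by
  obtain ⟨a, b, p', q', ⟨_, _, h1⟩, ⟨_, _, h2⟩, h3⟩ := hp.exists_isCycle_of_ne hq h
  have h4 := hn _ _ h3
  have h5 := congrArg length h1
  have h6 := congrArg length h2
  simp only [length_append, length_reverse] at h4 h5 h6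
  omega

lemma IsPath.exists_segment {u v : V} {p : G.Walk u v} (hp : p.IsPath) {i j : ℕ}
    (hi : i ≤ p.length) (hj : j ≤ p.length) :
    ∃ q : G.Walk (p.getVert i) (p.getVert j), q.IsPath ∧ q.length = (i - j) + (j - i) ∧
      ∀ a ∈ q.support, a ∈ p.support := by
  wlog hij : i ≤ j generalizing i j
  · obtain ⟨q, h1, h2, h3⟩ := this hj hi (by omega)
    exact ⟨q.reverse, h1.reverse, by simp; omega, by simpa using h3⟩
  have e : (p.drop i).getVert (j - i) = p.getVert j := by
    rw [drop_getVert]; congr 1; omega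
  refine ⟨((p.drop i).take (j - i)).copy rfl e, by simpa using (hp.drop i).take _, ?_, ?_⟩
  · simp; omega
  · intro a ha
    rw [support_copy] at ha
    exact ((p.drop i).isSubwalk_take _ |>.trans (p.isSubwalk_drop i)).support_subset ha

end SimpleGraph.Walk

section Holes

variable {G : SimpleGraph V}

lemma IsInducedPath.reverse {u v : V} {p : G.Walk u v} (h : IsInducedPath G p) :
    IsInducedPath G p.reverse :=
  ⟨h.1.reverse, by simpa using h.2⟩

lemma IsInducedPath.eq_or_eq_of_append {u v w : V} {p : G.Walk u v} {q : G.Walk v w}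
    (h : IsInducedPath G (p.append q)) {a b : V} (ha : a ∈ p.support) (hb : b ∈ q.support)
    (hab : a = b ∨ G.Adj a b) : a = v ∨ b = v := by
  rcases hab with rfl | hab
  · exact .inl (h.1.eq_of_mem_append ha hb)
  · have he := h.2 a (by simp [ha]) b (by simp [hb]) hab
    rw [Walk.edges_append, List.mem_append] at he
    rcases he with he | he
    · exact .inr (h.1.eq_of_mem_append (p.snd_mem_support_of_mem_edges he) hb)
    · exact .inl (h.1.eq_of_mem_append ha (q.fst_mem_support_of_mem_edges he))

lemma IsInducedPath.of_append_left {u v w : V} {p : G.Walk u v} {q : G.Walk v w}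
    (h : IsInducedPath G (p.append q)) : IsInducedPath G p := by
  refine ⟨h.1.of_append_left, fun a ha b hb hab => ?_⟩
  have he := h.2 a (by simp [ha]) b (by simp [hb]) hab
  rw [Walk.edges_append, List.mem_append] at he
  refine he.resolve_right fun he => hab.ne ?_
  rw [h.1.eq_of_mem_append ha (q.fst_mem_support_of_mem_edges he),
    h.1.eq_of_mem_append hb (q.snd_mem_support_of_mem_edges he)]

lemma IsInducedPath.of_append_right {u v w : V} {p : G.Walk u v} {q : G.Walk v w}
    (h : IsInducedPath G (p.append q)) : IsInducedPath G q := by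
  have := h.reverse
  rw [Walk.reverse_append] at this
  simpa using this.of_append_left.reverse

lemma IsInducedPath.append {u v w : V} {p : G.Walk u v} {q : G.Walk v w}
    (hp : IsInducedPath G p) (hq : IsInducedPath G q)
    (h : ∀ a ∈ p.support, ∀ b ∈ q.support, a = b ∨ G.Adj a b → a = v ∨ b = v) :
    IsInducedPath G (p.append q) := by
  have key : ∀ a ∈ p.support, ∀ b ∈ q.support, G.Adj a b → s(a, b) ∈ (p.append q).edges := by
    intro a ha b hb hab
    rw [Walk.edges_append, List.mem_append]
    rcases h a ha b hb (.inr hab) with rfl | rfl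
    · exact .inr (hq.2 _ (by simp) _ hb hab)
    · exact .inl (hp.2 _ ha _ (by simp) hab)
  refine ⟨hp.1.append_of_inter hq.1 fun a ha hb => by simpa using h a ha a hb (.inl rfl), ?_⟩
  intro a ha b hb hab
  rw [Walk.mem_support_append_iff] at ha hb
  rcases ha with ha | ha <;> rcases hb with hb | hb
  · rw [Walk.edges_append, List.mem_append]
    exact .inl (hp.2 a ha b hb hab)
  · exact key a ha b hb hab
  · rw [Sym2.eq_swap]
    exact key b hb a ha hab.symm
  · rw [Walk.edges_append, List.mem_append]
    exact .inr (hq.2 a ha b hb hab)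

lemma isInducedPath_toWalk {u v : V} (h : G.Adj u v) : IsInducedPath G h.toWalk :=
  ⟨.of_adj h, fun _ ha _ hb hab =>
    Walk.isChordless_iff_forall_mem_edges.1 h.isChordless_toWalk ha hb hab⟩

/-- The walks `p` and `q`, having the end `b` in common, are disjoint and anticomplete away from
`b`, except for a possible edge between their other ends `a` and `c`. -/
def MeetAt (G : SimpleGraph V) {s t s' t' : V} (p : G.Walk s t) (q : G.Walk s' t') (b a c : V) :
    Prop :=
  ∀ x ∈ p.support, ∀ y ∈ q.support, x = y ∨ G.Adj x y → x = b ∨ y = b ∨ (x = a ∧ y = c)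

/-- Three induced paths joining three vertices pairwise and otherwise anticomplete form a hole. -/
lemma isHole_of_meetAt {n : ℕ} (hn : ∀ (v : V) (c : G.Walk v v), c.IsCycle → n ≤ c.length)
    (h4 : 4 ≤ n) {a b c : V} {p : G.Walk a b} {q : G.Walk b c} {r : G.Walk a c}
    (hab : a ≠ b) (hbc : b ≠ c) (hac : a ≠ c)
    (hp : IsInducedPath G p) (hq : IsInducedPath G q) (hr : IsInducedPath G r)
    (hpq : MeetAt G p q b a c) (hpr : MeetAt G p r a b c) (hqr : MeetAt G q r c b a) :
    IsHole G ((p.append q).append r.reverse) := by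
  have lp : p.length ≠ 0 := fun h => hab (Walk.eq_of_length_eq_zero h)
  have lq : q.length ≠ 0 := fun h => hbc (Walk.eq_of_length_eq_zero h)
  have pp : (p.append q).IsPath := hp.1.append_of_inter hq.1 fun x hx hy => by
    have := hpq x hx x hy (.inl rfl)
    grind
  have hcyc : ((p.append q).append r.reverse).IsCycle := by
    refine pp.isCycle_append hr.1.reverse ?_ (.inl (by rw [Walk.length_append]; omega))
    intro x hx hy
    have h1 := pp.support_nodup
    have h2 := hr.1.reverse.support_nodup
    rw [← Walk.cons_tail_support, List.nodup_cons] at h1 h2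
    have hxa : x ≠ a := fun h => h1.1 (h ▸ hx)
    have hxc : x ≠ c := fun h => h2.1 (h ▸ hy)
    have hx := List.mem_of_mem_tail hx
    have hy := List.mem_of_mem_tail hy
    rw [Walk.support_reverse, List.mem_reverse] at hy
    rcases (Walk.mem_support_append_iff _ _).1 hx with hx | hx
    · have := hpr x hx x hy (.inl rfl)
      grind
    · have := hqr x hx x hy (.inl rfl)
      grind
  refine ⟨hcyc, h4.trans (hn _ _ hcyc), ?_⟩
  have m1 := p.start_mem_support
  have m2 := p.end_mem_support
  have m3 := q.start_mem_support
  have m4 := q.end_mem_support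
  have m5 := r.start_mem_support
  have m6 := r.end_mem_support
  have kpq : ∀ x ∈ p.support, ∀ y ∈ q.support, G.Adj x y →
      s(x, y) ∈ p.edges ∨ s(x, y) ∈ q.edges ∨ s(x, y) ∈ r.edges := by
    intro x hx y hy h
    rcases hpq x hx y hy (.inr h) with rfl | rfl | ⟨rfl, rfl⟩
    · exact .inr (.inl (hq.2 _ m3 _ hy h))
    · exact .inl (hp.2 _ hx _ m2 h)
    · exact .inr (.inr (hr.2 _ m5 _ m6 h))
  have kpr : ∀ x ∈ p.support, ∀ y ∈ r.support, G.Adj x y →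
      s(x, y) ∈ p.edges ∨ s(x, y) ∈ q.edges ∨ s(x, y) ∈ r.edges := by
    intro x hx y hy h
    rcases hpr x hx y hy (.inr h) with rfl | rfl | ⟨rfl, rfl⟩
    · exact .inr (.inr (hr.2 _ m5 _ hy h))
    · exact .inl (hp.2 _ hx _ m1 h)
    · exact .inr (.inl (hq.2 _ m3 _ m4 h))
  have kqr : ∀ x ∈ q.support, ∀ y ∈ r.support, G.Adj x y →
      s(x, y) ∈ p.edges ∨ s(x, y) ∈ q.edges ∨ s(x, y) ∈ r.edges := by
    intro x hx y hy h
    rcases hqr x hx y hy (.inr h) with rfl | rfl | ⟨rfl, rfl⟩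
    · exact .inr (.inr (hr.2 _ m6 _ hy h))
    · exact .inr (.inl (hq.2 _ hx _ m4 h))
    · exact .inl (hp.2 _ m2 _ m1 h)
  intro x hx y hy h
  simp only [Walk.mem_support_append_iff, Walk.support_reverse, List.mem_reverse,
    Walk.edges_append, Walk.edges_reverse, List.mem_append, or_assoc] at hx hy ⊢
  have hs : s(x, y) = s(y, x) := Sym2.eq_swap
  rcases hx with hx | hx | hx <;> rcases hy with hy | hy | hy
  · exact .inl (hp.2 x hx y hy h)
  · exact kpq x hx y hy h
  · exact kpr x hx y hy h
  · exact hs ▸ kpq y hy x hx h.symm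
  · exact .inr (.inl (hq.2 x hx y hy h))
  · exact kqr x hx y hy h
  · exact hs ▸ kpr y hy x hx h.symm
  · exact hs ▸ kqr y hy x hx h.symm
  · exact .inr (.inr (hr.2 x hx y hy h))

end Holes
section Uncrossed

variable {G : SimpleGraph V} {n : ℕ}

/-- A `K4`-subdivision with anticomplete arrises, two of whose faces are odd, is odd unless its
two other faces are even. -/
lemma hasOddK4_or_even (hn : ∀ (v : V) (c : G.Walk v v), c.IsCycle → n ≤ c.length) (h4 : 4 ≤ n)
    {a b c d : V} (hab : a ≠ b) (hac : a ≠ c) (had : a ≠ d) (hbc : b ≠ c) (hbd : b ≠ d)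
    (hcd : c ≠ d) {p₁ : G.Walk a b} {p₂ : G.Walk c d} {q₁ : G.Walk b c} {q₂ : G.Walk a d}
    {l₁ : G.Walk a c} {l₂ : G.Walk b d}
    (hp₁ : IsInducedPath G p₁) (hp₂ : IsInducedPath G p₂) (hq₁ : IsInducedPath G q₁)
    (hq₂ : IsInducedPath G q₂) (hl₁ : IsInducedPath G l₁) (hl₂ : IsInducedPath G l₂)
    (hp : ∀ x ∈ p₁.support, x ∉ p₂.support) (hq : ∀ x ∈ q₁.support, x ∉ q₂.support)
    (hl : ∀ x ∈ l₁.support, x ∉ l₂.support)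
    (p₁q₁ : MeetAt G p₁ q₁ b a c) (p₁l₁ : MeetAt G p₁ l₁ a b c) (q₁l₁ : MeetAt G q₁ l₁ c b a)
    (p₁l₂ : MeetAt G p₁ l₂ b a d) (p₁q₂ : MeetAt G p₁ q₂ a b d) (l₂q₂ : MeetAt G l₂ q₂ d b a)
    (q₁p₂ : MeetAt G q₁ p₂ c b d) (q₁l₂ : MeetAt G q₁ l₂ b c d) (p₂l₂ : MeetAt G p₂ l₂ d c b)
    (l₁p₂ : MeetAt G l₁ p₂ c a d) (l₁q₂ : MeetAt G l₁ q₂ a c d) (p₂q₂ : MeetAt G p₂ q₂ d c a)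
    (h₁ : Odd (p₁.length + q₁.length + l₁.length)) (h₂ : Odd (p₁.length + l₂.length + q₂.length)) :
    HasOddK4 G ∨
      (Even (q₁.length + p₂.length + l₂.length) ∧ n ≤ q₁.length + p₂.length + l₂.length ∧
        Even (l₁.length + p₂.length + q₂.length) ∧ n ≤ l₁.length + p₂.length + q₂.length) := by
  have f₁ := isHole_of_meetAt hn h4 hab hbc hac hp₁ hq₁ hl₁ p₁q₁ p₁l₁ q₁l₁
  have f₂ := isHole_of_meetAt hn h4 hab hbd had hp₁ hl₂ hq₂ p₁l₂ p₁q₂ l₂q₂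
  have f₃ := isHole_of_meetAt hn h4 hbc hcd hbd hq₁ hp₂ hl₂ q₁p₂ q₁l₂ p₂l₂
  have f₄ := isHole_of_meetAt hn h4 hac hcd had hl₁ hp₂ hq₂ l₁p₂ l₁q₂ p₂q₂
  have g₃ := hn _ _ f₃.1
  have g₄ := hn _ _ f₄.1
  simp only [Walk.length_append, Walk.length_reverse] at g₃ g₄
  by_cases ho : Odd (q₁.length + p₂.length + l₂.length)
  · left
    have ho' : Odd (l₁.length + p₂.length + q₂.length) := by grind
    refine ⟨⟨a, b, c, d, p₁, p₂, q₁, q₂, l₁, l₂, by simp [*], hp₁.1, hp₂.1, hq₁.1, hq₂.1, hl₁.1,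
      hl₂.1, hp, hq, hl⟩, ⟨f₁, ?_⟩, ⟨f₂, ?_⟩, ⟨f₃, ?_⟩, ⟨f₄, ?_⟩⟩ <;>
    simpa [K4Sub.C1, K4Sub.C2, K4Sub.C3, K4Sub.C4] using ‹_›
  · right
    have ho' : ¬ Odd (l₁.length + p₂.length + q₂.length) := by grind
    rw [Nat.not_odd_iff_even] at ho ho'
    exact ⟨ho, g₃, ho', g₄⟩

/-- The cycle `A ∪ X ∪ B ∪ Y` is a shortest odd hole, and `P` and `Q` are short jumps over it across
its disjoint arcs `A` and `B`. -/
structure UncrossedJumps (G : SimpleGraph V) (n : ℕ) {u₁ v₁ u₂ v₂ : V} (A P : G.Walk u₁ v₁)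
    (B Q : G.Walk u₂ v₂) (X : G.Walk u₁ u₂) (Y : G.Walk v₂ v₁) : Prop where
  le_length : ∀ (v : V) (c : G.Walk v v), c.IsCycle → n ≤ c.length
  length_le : ∀ (v : V) (c : G.Walk v v), IsOddHole G c → c.length ≤ n
  odd : Odd n
  four_le : 4 ≤ n
  indA : IsInducedPath G A
  indB : IsInducedPath G B
  indP : IsInducedPath G P
  indQ : IsInducedPath G Q
  indX : IsInducedPath G X
  indY : IsInducedPath G Y
  meetAX : ∀ a ∈ A.support, ∀ b ∈ X.support, a = b ∨ G.Adj a b → a = u₁ ∨ b = u₁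
  meetAY : ∀ a ∈ A.support, ∀ b ∈ Y.support, a = b ∨ G.Adj a b → a = v₁ ∨ b = v₁
  meetBX : ∀ a ∈ B.support, ∀ b ∈ X.support, a = b ∨ G.Adj a b → a = u₂ ∨ b = u₂
  meetBY : ∀ a ∈ B.support, ∀ b ∈ Y.support, a = b ∨ G.Adj a b → a = v₂ ∨ b = v₂
  meetXY : ∀ a ∈ X.support, ∀ b ∈ Y.support, ¬ (a = b ∨ G.Adj a b)
  meetAB : ∀ a ∈ A.support, ∀ b ∈ B.support, a = b ∨ G.Adj a b →
    (a = u₁ ∧ b = u₂) ∨ (a = v₁ ∧ b = v₂)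
  meetP : ∀ a ∈ P.support, ∀ c, (c ∈ A.support ∨ c ∈ B.support ∨ c ∈ X.support ∨ c ∈ Y.support) →
    a = c ∨ G.Adj a c → a = u₁ ∨ a = v₁ ∨ c = u₁ ∨ c = v₁
  meetQ : ∀ a ∈ Q.support, ∀ c, (c ∈ A.support ∨ c ∈ B.support ∨ c ∈ X.support ∨ c ∈ Y.support) →
    a = c ∨ G.Adj a c → a = u₂ ∨ a = v₂ ∨ c = u₂ ∨ c = v₂
  u₁_ne_v₁ : u₁ ≠ v₁
  u₂_ne_v₂ : u₂ ≠ v₂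
  u₁_ne_u₂ : u₁ ≠ u₂
  v₁_ne_v₂ : v₁ ≠ v₂
  two_le_A : 2 ≤ A.length
  two_le_B : 2 ≤ B.length
  length_cycle : A.length + X.length + B.length + Y.length = n
  length_P : P.length + A.length = n
  length_Q : Q.length + B.length = n

namespace UncrossedJumps

variable {u₁ v₁ u₂ v₂ : V} {A P : G.Walk u₁ v₁} {B Q : G.Walk u₂ v₂} {X : G.Walk u₁ u₂}
  {Y : G.Walk v₂ v₁}

lemma symm (h : UncrossedJumps G n A P B Q X Y) :
    UncrossedJumps G n A.reverse P.reverse B.reverse Q.reverse Y.reverse X.reverse where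
  le_length := h.le_length
  length_le := h.length_le
  odd := h.odd
  four_le := h.four_le
  indA := h.indA.reverse
  indB := h.indB.reverse
  indP := h.indP.reverse
  indQ := h.indQ.reverse
  indX := h.indY.reverse
  indY := h.indX.reverse
  meetAX := by simpa using h.meetAY
  meetAY := by simpa using h.meetAX
  meetBX := by simpa using h.meetBY
  meetBY := by simpa using h.meetBX
  meetXY := by
    intro a ha b hb hab
    rw [eq_comm, G.adj_comm] at hab
    exact h.meetXY b (by simpa using hb) a (by simpa using ha) hab
  meetAB := fun a ha b hb hab => (h.meetAB a (by simpa using ha) b (by simpa using hb) hab).symm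
  meetP := fun a ha c hc hac => by
    have := h.meetP a (by simpa using ha) c (by simp at hc; tauto) hac
    tauto
  meetQ := fun a ha c hc hac => by
    have := h.meetQ a (by simpa using ha) c (by simp at hc; tauto) hac
    tauto
  u₁_ne_v₁ := h.u₁_ne_v₁.symm
  u₂_ne_v₂ := h.u₂_ne_v₂.symm
  u₁_ne_u₂ := h.v₁_ne_v₂
  v₁_ne_v₂ := h.u₁_ne_u₂
  two_le_A := by simpa using h.two_le_A
  two_le_B := by simpa using h.two_le_B
  length_cycle := by simp; linarith [h.length_cycle]
  length_P := by simpa using h.length_P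
  length_Q := by simpa using h.length_Q

/-- Some internal vertex of `P` and some vertex of `Q` coincide or are adjacent. -/
lemma exists_contact (h : UncrossedJumps G n A P B Q X Y) :
    ∃ i ≤ Q.length, ∃ k, 0 < k ∧ k < P.length ∧
      (Q.getVert i = P.getVert k ∨ G.Adj (Q.getVert i) (P.getVert k)) := by
  by_contra! hcon
  have hPQ : ∀ a ∈ P.support, ∀ b ∈ Q.support, a = b ∨ G.Adj a b → a = u₁ ∨ a = v₁ := by
    intro a ha b hb hab
    obtain ⟨k, rfl, hk⟩ := Walk.mem_support_iff_exists_getVert.1 ha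
    obtain ⟨i, rfl, hi⟩ := Walk.mem_support_iff_exists_getVert.1 hb
    by_contra! hk'
    have hk0 : k ≠ 0 := by rintro rfl; simp at hk'
    have hk1 : k ≠ P.length := by rintro rfl; simp at hk'
    have := hcon i hi k (by omega) (by omega)
    rw [eq_comm, G.adj_comm] at hab
    tauto
  have mQu := Q.start_mem_support
  have mQv := Q.end_mem_support
  have mXu := X.start_mem_support
  have mXv := X.end_mem_support
  have mYu := Y.start_mem_support
  have mYv := Y.end_mem_support
  have hXY := h.meetXY
  have hQ := h.meetQ
  have hP := h.meetP
  have n1 := h.u₁_ne_u₂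
  have n2 := h.v₁_ne_v₂
  have n3 := h.u₁_ne_v₁
  have n4 := h.u₂_ne_v₂
  have n5 : u₁ ≠ v₂ := fun e => hXY _ mXu _ mYu (.inl e)
  have n6 : u₂ ≠ v₁ := fun e => hXY _ mXv _ mYv (.inl e)
  have iXQ : IsInducedPath G (X.append Q) := by
    refine h.indX.append h.indQ fun a ha b hb hab => ?_
    have h1 := hQ b hb a (by tauto) (by rwa [eq_comm, G.adj_comm])
    have h2 : a ≠ v₂ := fun e => hXY a ha _ mYu (.inl e)
    have h3 : b = v₂ → False := by rintro rfl; exact hXY a ha _ mYu hab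
    tauto
  have hole := isHole_of_meetAt h.le_length h.four_le n5 n2.symm n3 iXQ h.indY h.indP ?_ ?_ ?_
  · have l1 := h.length_cycle
    have l2 := h.length_P
    have l3 := h.length_Q
    have l4 : X.length ≠ 0 := fun e => n1 (Walk.eq_of_length_eq_zero e)
    have l5 := h.length_le _ _ ⟨hole, by
      obtain ⟨m, hm⟩ := h.odd
      exact ⟨m + X.length + Y.length, by simp; omega⟩⟩
    simp at l5
    omega
  · intro a ha b hb hab
    rcases (Walk.mem_support_append_iff _ _).1 ha with ha | ha
    · exact (hXY a ha b hb hab).elim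
    · have h1 := hQ a ha b (by tauto) hab
      have h2 : a = u₂ → False := by rintro rfl; exact hXY _ mXv b hb hab
      have h3 : b ≠ u₂ := fun e => hXY _ mXv b hb (.inl e.symm)
      tauto
  · intro a ha b hb hab
    rcases (Walk.mem_support_append_iff _ _).1 ha with ha | ha
    · have h1 := hP b hb a (by tauto) (by rwa [eq_comm, G.adj_comm])
      have h2 : a ≠ v₁ := fun e => hXY a ha _ mYv (.inl e)
      have h3 : b = v₁ → False := by rintro rfl; exact hXY a ha _ mYv hab
      tauto
    · rcases hPQ b hb a ha (by rwa [eq_comm, G.adj_comm]) with rfl | rfl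
      · tauto
      · have h1 := hQ a ha b (by tauto) hab
        have h2 : a = u₂ → False := by rintro rfl; exact hXY _ mXv _ mYv hab
        have h3 : b ≠ u₂ := fun e => hXY _ mXv b mYv (.inl e.symm)
        tauto
  · intro a ha b hb hab
    have h1 := hP b hb a (by tauto) (by rwa [eq_comm, G.adj_comm])
    have h2 : a ≠ u₁ := fun e => hXY _ mXu a ha (.inl e.symm)
    have h3 : b = u₁ → False := by
      rintro rfl
      exact hXY _ mXu a ha (by rwa [eq_comm, G.adj_comm])
    tauto


/-- A vertex off `P` has at most one neighbour on `P`. -/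
lemma eq_of_adj_of_adj (h : UncrossedJumps G n A P B Q X Y) {y : V} (hy : y ∉ P.support)
    {i j : ℕ} (hi : 0 < i ∧ i < P.length) (hj : 0 < j ∧ j < P.length)
    (hyi : G.Adj y (P.getVert i)) (hyj : G.Adj y (P.getVert j)) : i = j := by
  by_contra hij
  obtain ⟨q, h1, h2, h3⟩ := h.indP.1.exists_segment hi.2.le hj.2.le
  have hne : P.getVert i ≠ P.getVert j := fun e => hij (h.indP.1.getVert_injOn hi.2.le hj.2.le e)
  have hp : (hyi.symm.toWalk.append hyj.toWalk).IsPath := by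
    refine (Walk.IsPath.of_adj _).append_of_inter (.of_adj _) ?_
    simp only [SimpleGraph.Adj.support_toWalk, List.mem_cons, List.not_mem_nil, or_false]
    grind
  have hd : q ≠ hyi.symm.toWalk.append hyj.toWalk := by
    rintro rfl
    exact hy (h3 y (by simp))
  have := h1.length_add_length_ge_of_ne h.le_length hp hd
  have l1 := h.two_le_A
  have l2 := h.length_P
  simp at this
  omega

lemma u₁_ne_v₂ (h : UncrossedJumps G n A P B Q X Y) : u₁ ≠ v₂ :=
  fun e => h.meetXY _ X.start_mem_support _ Y.start_mem_support (.inl e)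

lemma u₂_ne_v₁ (h : UncrossedJumps G n A P B Q X Y) : u₂ ≠ v₁ :=
  fun e => h.meetXY _ X.end_mem_support _ Y.end_mem_support (.inl e)

lemma getVert_P_ne (h : UncrossedJumps G n A P B Q X Y) {m : ℕ} (h0 : 0 < m) (hm : m < P.length) :
    P.getVert m ≠ u₁ ∧ P.getVert m ≠ v₁ := by
  refine ⟨fun e => ?_, fun e => ?_⟩
  · rw [h.indP.1.getVert_eq_start_iff hm.le] at e; omega
  · rw [h.indP.1.getVert_eq_end_iff hm.le] at e; omega

lemma eq_or_eq_of_meet_getVert_P (h : UncrossedJumps G n A P B Q X Y) {m : ℕ} (h0 : 0 < m)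
    (hm : m < P.length) {c : V}
    (hc : c ∈ A.support ∨ c ∈ B.support ∨ c ∈ X.support ∨ c ∈ Y.support)
    (hcm : c = P.getVert m ∨ G.Adj c (P.getVert m)) : c = u₁ ∨ c = v₁ := by
  have h1 := h.meetP _ (P.getVert_mem_support m) c hc (by rwa [eq_comm, G.adj_comm])
  have h2 := h.getVert_P_ne h0 hm
  clear hc hcm h
  tauto

/-- The contact of `Q` with the interior of `P` that is nearest to `u₂`. -/
lemma exists_first_contact (h : UncrossedJumps G n A P B Q X Y) :
    ∃ i k, 0 < i ∧ i < Q.length ∧ 0 < k ∧ k < P.length ∧ Q.getVert i ∉ P.support ∧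
      G.Adj (Q.getVert i) (P.getVert k) ∧
      ∀ j < i, ∀ m, 0 < m → m < P.length →
        ¬ (Q.getVert j = P.getVert m ∨ G.Adj (Q.getVert j) (P.getVert m)) := by
  classical
  have hex := h.exists_contact
  set T : ℕ → Prop := fun i => i ≤ Q.length ∧ ∃ k, 0 < k ∧ k < P.length ∧
      (Q.getVert i = P.getVert k ∨ G.Adj (Q.getVert i) (P.getVert k)) with hT
  change ∃ i, T i at hex
  obtain ⟨i, hTi, hmin⟩ : ∃ i, T i ∧ ∀ j < i, ¬ T j :=
    ⟨Nat.find hex, Nat.find_spec hex, fun j hj => Nat.find_min hex hj⟩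
  obtain ⟨hiQ, k, hk0, hkP, hik⟩ := hTi
  have hi0 : 0 < i := by
    by_contra hi
    obtain rfl : i = 0 := by omega
    rw [Walk.getVert_zero] at hik
    exact (h.eq_or_eq_of_meet_getVert_P hk0 hkP (by simp) hik).elim h.u₁_ne_u₂.symm h.u₂_ne_v₁
  have hiQ : i < Q.length := by
    refine lt_of_le_of_ne hiQ ?_
    rintro rfl
    rw [Walk.getVert_length] at hik
    exact (h.eq_or_eq_of_meet_getVert_P hk0 hkP (by simp) hik).elim h.u₁_ne_v₂.symm h.v₁_ne_v₂.symm
  have hmin' : ∀ j < i, ∀ m, 0 < m → m < P.length →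
      ¬ (Q.getVert j = P.getVert m ∨ G.Adj (Q.getVert j) (P.getVert m)) :=
    fun j hj m h0 hm hjm => hmin j hj ⟨by omega, m, h0, hm, hjm⟩
  have hpred : G.Adj (Q.getVert (i - 1)) (Q.getVert i) := by
    have := Q.adj_getVert_succ (i := i - 1) (by omega)
    rwa [Nat.sub_add_cancel hi0] at this
  have hnotP : ∀ m, 0 < m → m < P.length → Q.getVert i ≠ P.getVert m := fun m h0 hm e =>
    hmin' (i - 1) (by omega) m h0 hm (.inr (e ▸ hpred))
  refine ⟨i, k, hi0, hiQ, hk0, hkP, fun hm => ?_, hik.resolve_left (hnotP k hk0 hkP), hmin'⟩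
  obtain ⟨m, hm, hmP⟩ := Walk.mem_support_iff_exists_getVert.1 hm
  have Qne : Q.getVert i ≠ u₂ ∧ Q.getVert i ≠ v₂ := by
    refine ⟨fun e => ?_, fun e => ?_⟩
    · rw [h.indQ.1.getVert_eq_start_iff hiQ.le] at e; omega
    · rw [h.indQ.1.getVert_eq_end_iff hiQ.le] at e; omega
  by_cases m0 : m = 0
  · subst m0
    rw [Walk.getVert_zero] at hm
    have := h.meetQ _ (Q.getVert_mem_support i) u₁ (by simp) (.inl hm.symm)
    rw [← hm] at this Qne
    grind
  by_cases m1 : m = P.length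
  · subst m1
    rw [Walk.getVert_length] at hm
    have := h.meetQ _ (Q.getVert_mem_support i) v₁ (by simp) (.inl hm.symm)
    rw [← hm] at this Qne
    grind
  exact hnotP m (by omega) (by omega) hm.symm

/-- The first part of `Q`, up to the contact with the interior of `P` nearest to `u₂`. -/
lemma meet_take (h : UncrossedJumps G n A P B Q X Y) {i k : ℕ} (hiQ : i < Q.length)
    (hk0 : 0 < k) (hkP : k < P.length) (hiP : Q.getVert i ∉ P.support)
    (hadj : G.Adj (Q.getVert i) (P.getVert k))
    (hmin : ∀ j < i, ∀ m, 0 < m → m < P.length →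
      ¬ (Q.getVert j = P.getVert m ∨ G.Adj (Q.getVert j) (P.getVert m))) :
    ∀ r ∈ (Q.take i).support, ∀ p ∈ P.support, r = p ∨ G.Adj r p →
      (r = Q.getVert i ∧ p = P.getVert k) ∨ (r = u₂ ∧ (p = u₁ ∨ p = v₁)) := by
  intro r hr p hp hrp
  obtain ⟨j, rfl, hj⟩ := Walk.mem_support_iff_exists_getVert.1 hr
  rw [Walk.take_getVert] at hrp ⊢
  rw [Walk.take_length] at hj
  obtain ⟨m, rfl, hm⟩ := Walk.mem_support_iff_exists_getVert.1 hp
  have hmQ := Q.getVert_mem_support (i ⊓ j)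
  have hv : Q.getVert (i ⊓ j) ≠ v₂ := fun e => by
    rw [h.indQ.1.getVert_eq_end_iff (by omega)] at e; omega
  by_cases m0 : m = 0
  · subst m0
    rw [Walk.getVert_zero] at hrp ⊢
    have h1 := h.meetQ _ hmQ u₁ (by simp) hrp
    exact .inr ⟨((h1.resolve_right fun h2 => (h2.resolve_left hv).elim h.u₁_ne_u₂ h.u₁_ne_v₂)),
      .inl rfl⟩
  by_cases m1 : m = P.length
  · subst m1
    rw [Walk.getVert_length] at hrp ⊢
    have h1 := h.meetQ _ hmQ v₁ (by simp) hrp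
    exact .inr ⟨((h1.resolve_right fun h2 => (h2.resolve_left hv).elim h.u₂_ne_v₁.symm
      h.v₁_ne_v₂)), .inr rfl⟩
  have hji : i ⊓ j = i := by
    by_contra hne
    exact hmin (i ⊓ j) (by omega) m (by omega) (by omega) hrp
  rw [hji] at hrp ⊢
  have hrp := hrp.resolve_left fun e => hiP (e ▸ P.getVert_mem_support m)
  rw [h.eq_of_adj_of_adj hiP ⟨by omega, by omega⟩ ⟨hk0, hkP⟩ hrp hadj]
  exact .inl ⟨rfl, rfl⟩

/-- An initial part of `Q` missing at least two vertices meets the cycle in `u₂` only. -/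
lemma meet_take_cycle (h : UncrossedJumps G n A P B Q X Y) {i : ℕ} (hi : i + 1 < Q.length) :
    ∀ r ∈ (Q.take i).support, ∀ c,
      (c ∈ A.support ∨ c ∈ B.support ∨ c ∈ X.support ∨ c ∈ Y.support) →
      r = c ∨ G.Adj r c → r = u₂ ∨ c = u₂ := by
  have iQ := h.indQ
  have hQs := Q.append_take_drop_eq i
  rw [← hQs] at iQ
  have hnv : ¬ G.Adj (Q.getVert i) v₂ := by
    intro hv
    by_cases he : Q.drop i = hv.toWalk
    · have := congrArg Walk.length he
      simp at this
      omega
    · have := iQ.1.of_append_right.length_add_length_ge_of_ne h.le_length (.of_adj hv) he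
      have l1 := h.length_Q
      have l2 := h.two_le_B
      simp at this
      omega
  intro r hr c hc hrc
  have h1 : r ∈ Q.support := by rw [← hQs, Walk.mem_support_append_iff]; exact .inl hr
  have hne : ∀ j ≤ i, Q.getVert j ≠ v₂ := fun j hj e => by
    rw [h.indQ.1.getVert_eq_end_iff (by omega)] at e; omega
  have h2 : r ≠ v₂ := by
    obtain ⟨j, rfl, hj⟩ := Walk.mem_support_iff_exists_getVert.1 hr
    rw [Walk.take_getVert]
    exact hne _ (by omega)
  have h3 : c ≠ v₂ := by
    rintro rfl
    obtain rfl := (iQ.eq_or_eq_of_append hr (Walk.end_mem_support _) hrc).resolve_right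
      (hne i le_rfl).symm
    exact hrc.elim h2 hnv
  rcases h.meetQ r h1 c hc hrc with h4 | h4 | h4 | h4
  · exact .inl h4
  · exact (h2 h4).elim
  · exact .inr h4
  · exact (h3 h4).elim

/-- The contact of `Q` with the interior of `P` that is nearest to `u₂` spans a `K4`-subdivision
together with `A ∪ X ∪ B ∪ Y` and `P`. -/
lemma hasOddK4_or_even_of_contact (h : UncrossedJumps G n A P B Q X Y) {i k : ℕ}
    (hiQ : i + 1 < Q.length) (hk0 : 0 < k) (hkP : k < P.length)
    (hiP : Q.getVert i ∉ P.support) (hadj : G.Adj (Q.getVert i) (P.getVert k))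
    (hmin : ∀ j < i, ∀ m, 0 < m → m < P.length →
      ¬ (Q.getVert j = P.getVert m ∨ G.Adj (Q.getVert j) (P.getVert m))) :
    HasOddK4 G ∨
      (Even (B.length + Y.length + (i + 1) + (P.length - k)) ∧
        n ≤ B.length + Y.length + (i + 1) + (P.length - k) ∧
        Even (X.length + (i + 1) + k) ∧ n ≤ X.length + (i + 1) + k) := by
  have hQ1 := h.meet_take (by omega) hk0 hkP hiP hadj hmin
  have hQ2 := h.meet_take_cycle hiQ
  have hxne := h.getVert_P_ne hk0 hkP
  have hP' := fun c => h.eq_or_eq_of_meet_getVert_P hk0 hkP (c := c)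
  have iQ := h.indQ
  have iP := h.indP
  have hPs := P.append_take_drop_eq k
  rw [← Q.append_take_drop_eq i] at iQ
  rw [← hPs] at iP
  have hPsub : ∀ a, a ∈ (P.take k).support ∨ a ∈ (P.drop k).support → a ∈ P.support := by
    intro a ha
    rw [← hPs, Walk.mem_support_append_iff]
    exact ha
  set x := P.getVert k with hx
  have iR : IsInducedPath G ((Q.take i).append hadj.toWalk) := by
    refine iQ.of_append_left.append (isInducedPath_toWalk hadj) fun a ha b hb hab => ?_
    rw [SimpleGraph.Adj.support_toWalk, List.mem_cons, List.mem_singleton] at hb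
    rcases hb with rfl | rfl
    · exact .inr rfl
    · rcases hQ1 a ha _ (P.getVert_mem_support k) hab with h1 | ⟨-, h1⟩
      · exact .inl h1.1
      · exact (h1.elim hxne.1 hxne.2).elim
  set R := (Q.take i).append hadj.toWalk with hR
  have memR : ∀ r, r ∈ R.support → r ∈ (Q.take i).support ∨ r = x := by
    intro r hr
    rw [hR, Walk.mem_support_append_iff, SimpleGraph.Adj.support_toWalk, List.mem_cons,
      List.mem_singleton] at hr
    rcases hr with hr | rfl | rfl
    · exact .inl hr
    · exact .inl (Walk.end_mem_support _)
    · exact .inr rfl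
  have RP : ∀ r ∈ R.support, ∀ p ∈ P.support, r = p ∨ G.Adj r p →
      r = x ∨ p = x ∨ (r = u₂ ∧ (p = u₁ ∨ p = v₁)) := by
    intro r hr p hp hrp
    rcases memR r hr with hr | rfl
    · exact (hQ1 r hr p hp hrp).elim (fun h1 => .inr (.inl h1.2)) fun h1 => .inr (.inr h1)
    · exact .inl rfl
  have RC : ∀ r ∈ R.support, ∀ c,
      (c ∈ A.support ∨ c ∈ B.support ∨ c ∈ X.support ∨ c ∈ Y.support) →
      r = c ∨ G.Adj r c → r = u₂ ∨ c = u₂ ∨ (r = x ∧ (c = u₁ ∨ c = v₁)) := by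
    intro r hr c hc hrc
    rcases memR r hr with hr | rfl
    · exact (hQ2 r hr c hc hrc).elim .inl fun h1 => .inr (.inl h1)
    · exact .inr (.inr ⟨rfl, hP' c hc (by rwa [eq_comm, G.adj_comm])⟩)
  have iBY : IsInducedPath G (B.append Y) := h.indB.append h.indY h.meetBY
  have uBY : ∀ c ∈ (B.append Y).support, c ≠ u₁ := by
    rintro c hc rfl
    rcases (Walk.mem_support_append_iff _ _).1 hc with hc | hc
    · exact (h.meetAB _ A.start_mem_support _ hc (.inl rfl)).elim (fun e => h.u₁_ne_u₂ e.2)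
        fun e => h.u₁_ne_v₁ e.1
    · exact h.meetXY _ X.start_mem_support _ hc (.inl rfl)
  have vX : ∀ c ∈ X.support, c ≠ v₁ := by
    rintro c hc rfl
    exact h.meetXY _ hc _ Y.end_mem_support (.inl rfl)
  have vPa : ∀ a ∈ (P.take k).support, a ≠ v₁ := by
    rintro a ha rfl
    exact hxne.2 (iP.1.eq_of_mem_append ha (Walk.end_mem_support _)).symm
  have uPb : ∀ a ∈ (P.drop k).support, a ≠ u₁ := by
    rintro a ha rfl
    exact hxne.1 (iP.1.eq_of_mem_append (Walk.start_mem_support _) ha).symm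
  have vPa' : ∀ a ∈ (P.take k).support, G.Adj a v₁ → a = x := fun a ha hav =>
    (iP.eq_or_eq_of_append ha (Walk.end_mem_support _) (.inr hav)).resolve_right hxne.2.symm
  have uPb' : ∀ a ∈ (P.drop k).support, G.Adj a u₁ → a = x := fun a ha hau =>
    (iP.eq_or_eq_of_append (Walk.start_mem_support _) ha (.inr hau.symm)).resolve_left hxne.1.symm
  have xu₂ : x ≠ u₂ := fun e =>
    (hP' u₂ (by simp) (.inl e.symm)).elim h.u₁_ne_u₂.symm h.u₂_ne_v₁
  have memBY : ∀ c ∈ (B.append Y).support,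
      c ∈ A.support ∨ c ∈ B.support ∨ c ∈ X.support ∨ c ∈ Y.support := by
    intro c hc
    rcases (Walk.mem_support_append_iff _ _).1 hc with hc | hc <;> simp [hc]
  have lR : R.length = i + 1 := by
    rw [hR, Walk.length_append, Walk.take_length, SimpleGraph.Adj.length_toWalk]
    omega
  have lBY : (B.append Y).length = B.length + Y.length := Walk.length_append _ _
  have lPa : (P.take k).length = k := by
    rw [Walk.take_length]
    omega
  have lPb : (P.drop k).length = P.length - k := Walk.drop_length _ _
  have l1 := h.length_cycle
  have l2 := h.length_P
  have hodd := h.odd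
  have uA : ∀ a ∈ A.support, a ≠ u₂ := by
    rintro a ha rfl
    exact (h.meetAB _ ha _ B.start_mem_support (.inl rfl)).elim (fun e => h.u₁_ne_u₂ e.1.symm)
      fun e => h.u₂_ne_v₁ e.1
  have PC := fun c hc p hp (hcp : c = p ∨ G.Adj c p) =>
    h.meetP p hp c hc (by rwa [eq_comm, G.adj_comm])
  have ABY : ∀ a ∈ A.support, ∀ c ∈ (B.append Y).support, a = c ∨ G.Adj a c →
      a = v₁ ∨ c = v₁ ∨ (a = u₁ ∧ c = u₂) := by
    intro a ha c hc hac
    rcases (Walk.mem_support_append_iff _ _).1 hc with hc | hc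
    · exact (h.meetAB a ha c hc hac).elim (fun e => .inr (.inr e)) fun e => .inl e.1
    · exact (h.meetAY a ha c hc hac).elim .inl fun e => .inr (.inl e)
  have BYX : ∀ c ∈ (B.append Y).support, ∀ a ∈ X.support, c = a ∨ G.Adj c a →
      c = u₂ ∨ a = u₂ := by
    intro c hc a ha hac
    rcases (Walk.mem_support_append_iff _ _).1 hc with hc | hc
    · exact h.meetBX c hc a ha hac
    · exact (h.meetXY a ha c hc (by rwa [eq_comm, G.adj_comm])).elim
  have AX := h.meetAX
  have PP : ∀ a ∈ (P.take k).support, ∀ b ∈ (P.drop k).support, a = b ∨ G.Adj a b → a = x ∨ b = x :=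
    fun a ha b hb => iP.eq_or_eq_of_append ha hb
  have PP' := fun b hb a ha (hba : b = a ∨ G.Adj b a) =>
    PP a ha b hb (by rwa [eq_comm, G.adj_comm])
  have CR := fun c hc r hr (hcr : c = r ∨ G.Adj c r) =>
    RC r hr c hc (by rwa [eq_comm, G.adj_comm])
  have main := hasOddK4_or_even (p₁ := A) (p₂ := R) (q₁ := (B.append Y).reverse)
    (q₂ := P.take k) (l₁ := X) (l₂ := (P.drop k).reverse)
    h.le_length h.four_le h.u₁_ne_v₁ h.u₁_ne_u₂ hxne.1.symm h.u₂_ne_v₁.symm hxne.2.symm xu₂.symm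
    h.indA iR iBY.reverse iP.of_append_left h.indX iP.of_append_right.reverse
  simp only [MeetAt, Walk.support_reverse, List.mem_reverse, Walk.length_reverse, lR, lBY, lPa,
    lPb] at main
  clear_value R
  clear hQ1 hQ2 hP' iQ iP hPs iR memR iBY hadj hiP hmin hiQ hR lR lBY lPa lPb h
  apply main <;> clear main
  · grind
  · grind
  · grind
  · grind
  · grind
  · grind
  · intro a ha p hp hap
    rcases PC a (.inl ha) p (hPsub p (.inr hp)) hap with e | e | rfl | e
    · exact (uPb p hp e).elim
    · exact .inr (.inl e)
    · exact .inr (.inr ⟨rfl, hap.elim (fun e => (uPb p hp e.symm).elim) fun e => uPb' p hp e.symm⟩)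
    · exact .inl e
  · intro a ha p hp hap
    rcases PC a (.inl ha) p (hPsub p (.inl hp)) hap with e | e | e | rfl
    · exact .inr (.inl e)
    · exact (vPa p hp e).elim
    · exact .inl e
    · exact .inr (.inr ⟨rfl, hap.elim (fun e => (vPa p hp e.symm).elim) fun e => vPa' p hp e.symm⟩)
  all_goals grind

lemma length_add_or_length_eq (h : UncrossedJumps G n A P B Q X Y) {y z : V} (hy : y ∉ P.support)
    (hz : z ∉ P.support) (hyz : y ≠ z) {i j : ℕ} (hi : i ≤ P.length) (hj : j ≤ P.length)
    (hyi : G.Adj y (P.getVert i)) (hzj : G.Adj z (P.getVert j)) {q : G.Walk y z} (hq : q.IsPath) :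
    n ≤ q.length + ((i - j) + (j - i) + 2) ∨ q.length = (i - j) + (j - i) + 2 := by
  obtain ⟨p, hp, lp, hpP⟩ := h.indP.1.exists_segment hi hj
  have hr : (hyi.toWalk.append (p.append hzj.symm.toWalk)).IsPath := by
    refine (Walk.IsPath.of_adj _).append_of_inter (hp.append_of_inter (.of_adj _) ?_) ?_
    · simp only [SimpleGraph.Adj.support_toWalk, List.mem_cons, List.not_mem_nil, or_false]
      rintro a ha (rfl | rfl)
      · rfl
      · exact (hz (hpP _ ha)).elim
    · simp only [SimpleGraph.Adj.support_toWalk, List.mem_cons, List.not_mem_nil, or_false,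
        Walk.mem_support_append_iff]
      rintro a (rfl | rfl) ha
      · rcases ha with ha | rfl | rfl
        · exact (hy (hpP _ ha)).elim
        · exact (hy (P.getVert_mem_support _)).elim
        · exact (hyz rfl).elim
      · rfl
  have lr : (hyi.toWalk.append (p.append hzj.symm.toWalk)).length = p.length + 2 := by
    simp only [Walk.length_append, SimpleGraph.Adj.length_toWalk]
    omega
  rw [← lp, ← lr]
  by_cases hqr : q = hyi.toWalk.append (p.append hzj.symm.toWalk)
  · exact .inr (congrArg _ hqr)
  · exact .inl (hq.length_add_length_ge_of_ne h.le_length hr hqr)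

/-- Two disjoint arcs of a shortest odd hole with short jumps across them give an odd
`K4`-subdivision. -/
theorem hasOddK4 (h : UncrossedJumps G n A P B Q X Y) : HasOddK4 G := by
  obtain ⟨i, k, hi0, hiQ, hk0, hkP, hiP, hadj, hmin⟩ := h.exists_first_contact
  obtain ⟨i', k', hi0', hiQ', hk0', hkP', hiP', hadj', hmin'⟩ := h.symm.exists_first_contact
  have H := fun hh => h.hasOddK4_or_even_of_contact (i := i) hh hk0 hkP hiP hadj hmin
  have H' := fun hh => h.symm.hasOddK4_or_even_of_contact (i := i') hh hk0' hkP' hiP' hadj' hmin'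
  clear hmin'
  simp only [Walk.length_reverse, Walk.getVert_reverse, Walk.support_reverse, List.mem_reverse]
    at hiQ' hkP' hiP' hadj' H'
  by_contra hno
  replace H := fun hh => (H hh).resolve_left hno
  replace H' := fun hh => (H' hh).resolve_left hno
  obtain ⟨j, hj, hj'⟩ : ∃ j, Q.length - i' = j ∧ i' + j = Q.length := ⟨_, rfl, by omega⟩
  obtain ⟨s, hs, hs'⟩ : ∃ s, P.length - k = s ∧ k + s = P.length := ⟨_, rfl, by omega⟩
  obtain ⟨r, hr, hr'⟩ : ∃ r, P.length - k' = r ∧ k' + r = P.length := ⟨_, rfl, by omega⟩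
  rw [hj] at hiP'
  rw [hj, hr] at hadj'
  rw [hs] at H
  rw [hr] at H'
  clear hj hs hr
  have hA := h.two_le_A
  have hB := h.two_le_B
  have lC := h.length_cycle
  have lP := h.length_P
  have lQ := h.length_Q
  obtain ⟨t, ht⟩ := h.odd
  have hij : i ≤ j := by
    by_contra hlt
    exact hmin j (by omega) r (by omega) (by omega) (.inr hadj')
  by_cases hi : i + 1 < Q.length
  swap
  · obtain ⟨⟨a, ha⟩, h1, ⟨b, hb⟩, h2⟩ := H' (by
      have : X.length ≠ 0 := fun e => h.u₁_ne_u₂ (Walk.eq_of_length_eq_zero e)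
      omega)
    clear H H'
    omega
  by_cases hi' : i' + 1 < Q.length
  swap
  · obtain ⟨⟨a, ha⟩, h1, ⟨b, hb⟩, h2⟩ := H hi
    clear H H'
    omega
  obtain ⟨⟨a, ha⟩, h1, ⟨b, hb⟩, h2⟩ := H hi
  obtain ⟨⟨a', ha'⟩, h1', ⟨b', hb'⟩, h2'⟩ := H' hi'
  clear H H'
  by_cases hy : i = j
  · subst hy
    have := h.eq_of_adj_of_adj hiP ⟨hk0, hkP⟩ ⟨by omega, by omega⟩ hadj hadj'
    omega
  have hy' : Q.getVert i ≠ Q.getVert j := fun e =>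
    hy (h.indQ.1.getVert_injOn hiQ.le (show j ≤ Q.length by omega) e)
  obtain ⟨q, hq, lq, -⟩ := h.indQ.1.exists_segment hiQ.le (show j ≤ Q.length by omega)
  replace lq : q.length + i = j := by
    clear * - lq hij
    omega
  have hlen := h.length_add_or_length_eq hiP hiP' hy' hkP.le (by omega) hadj hadj' hq
  clear hiP hiP' hadj hadj' hmin hy' hq
  obtain ⟨d, hd⟩ | ⟨d, hd⟩ := (le_total k r).imp Nat.exists_eq_add_of_le Nat.exists_eq_add_of_le
  · rw [hd, Nat.sub_eq_zero_of_le (Nat.le_add_right k d), zero_add, Nat.add_sub_cancel_left] at hlen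
    obtain hlen | hlen := hlen <;> omega
  · rw [hd, Nat.sub_eq_zero_of_le (Nat.le_add_right r d), add_zero, Nat.add_sub_cancel_left] at hlen
    obtain hlen | hlen := hlen <;> omega

end UncrossedJumps

end Uncrossed

section Arcs

variable {G : SimpleGraph V} {v x y : V} {w : G.Walk v v} {A B : G.Walk x y}

namespace ArcsOf

lemma symm (h : ArcsOf G w A B) : ArcsOf G w B A := by
  obtain ⟨h1, h2, h3, h4, h5, h6, h7⟩ := h
  exact ⟨h1, h2, h3, h5, h4, by rw [Set.inter_comm, h6], by rw [Set.union_comm, h7]⟩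

lemma reverse (h : ArcsOf G w A B) : ArcsOf G w A.reverse B.reverse := by
  obtain ⟨h1, h2, h3, h4, h5, h6, h7⟩ := h
  exact ⟨h2, h1, h3.symm, h4.reverse, h5.reverse, by simpa [Set.pair_comm y x] using h6,
    by simpa using h7⟩

lemma eq_or_eq (h : ArcsOf G w A B) {a : V} (hA : a ∈ A.support) (hB : a ∈ B.support) :
    a = x ∨ a = y := by
  have : a ∈ ({x, y} : Set V) := h.2.2.2.2.2.1 ▸ ⟨hA, hB⟩
  simpa using this

lemma mem_edges_iff (h : ArcsOf G w A B) {e : Sym2 V} :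
    e ∈ w.edges ↔ e ∈ A.edges ∨ e ∈ B.edges :=
  Set.ext_iff.1 h.2.2.2.2.2.2 e

lemma mem_support_iff (h : ArcsOf G w A B) (hw : IsHole G w) {a : V} :
    a ∈ w.support ↔ a ∈ A.support ∨ a ∈ B.support := by
  have hA : ¬ A.Nil := Walk.not_nil_of_ne h.2.2.1
  have hB : ¬ B.Nil := Walk.not_nil_of_ne h.2.2.1
  rw [Walk.mem_support_iff_exists_mem_edges_of_not_nil hw.1.not_nil,
    Walk.mem_support_iff_exists_mem_edges_of_not_nil hA,
    Walk.mem_support_iff_exists_mem_edges_of_not_nil hB]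
  simp only [h.mem_edges_iff, or_and_right, exists_or]

lemma edges_disjoint (h : ArcsOf G w A B) (hxy : ¬ G.Adj x y) : A.edges.Disjoint B.edges := by
  intro e hA hB
  induction e with
  | h a b =>
    have hab := A.adj_of_mem_edges hA
    have := h.eq_or_eq (A.fst_mem_support_of_mem_edges hA) (B.fst_mem_support_of_mem_edges hB)
    have := h.eq_or_eq (A.snd_mem_support_of_mem_edges hA) (B.snd_mem_support_of_mem_edges hB)
    have := hab.ne
    have := hab.symm
    grind

lemma length_add (h : ArcsOf G w A B) (hw : IsHole G w) (hxy : ¬ G.Adj x y) :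
    A.length + B.length = w.length := by
  have hn : (A.edges ++ B.edges).Nodup :=
    List.nodup_append'.2 ⟨h.2.2.2.1.isTrail.edges_nodup, h.2.2.2.2.1.isTrail.edges_nodup,
      h.edges_disjoint hxy⟩
  have := ((List.perm_ext_iff_of_nodup hw.1.edges_nodup hn).2 fun e => by
    rw [h.mem_edges_iff, List.mem_append]).length_eq
  simpa using this.symm

lemma isInducedPath (h : ArcsOf G w A B) (hw : IsHole G w) (hxy : ¬ G.Adj x y) :
    IsInducedPath G A := by
  refine ⟨h.2.2.2.1, fun a ha b hb hab => ?_⟩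
  have ha' := (h.mem_support_iff hw).2 (.inl ha)
  have hb' := (h.mem_support_iff hw).2 (.inl hb)
  refine (h.mem_edges_iff.1 (hw.2.2 a ha' b hb' hab)).resolve_right fun hB => ?_
  have := h.eq_or_eq ha (B.fst_mem_support_of_mem_edges hB)
  have := h.eq_or_eq hb (B.snd_mem_support_of_mem_edges hB)
  have := hab.ne
  have := hab.symm
  grind

lemma eq_or_eq_of_meet (h : ArcsOf G w A B) (hw : IsHole G w) {a b : V} (ha : a ∈ A.support)
    (hb : b ∈ B.support) (hab : a = b ∨ G.Adj a b) : (a = x ∨ a = y) ∨ b = x ∨ b = y := by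
  rcases hab with rfl | hab
  · exact .inl (h.eq_or_eq ha hb)
  · have ha' := (h.mem_support_iff hw).2 (.inl ha)
    have hb' := (h.mem_support_iff hw).2 (.inr hb)
    rcases h.mem_edges_iff.1 (hw.2.2 a ha' b hb' hab) with he | he
    · exact .inr (h.eq_or_eq (A.snd_mem_support_of_mem_edges he) hb)
    · exact .inl (h.eq_or_eq ha (B.fst_mem_support_of_mem_edges he))

end ArcsOf

lemma IsJump.two_le_length {p : G.Walk x y} (h : IsJump G w p) (q : G.Walk x y) :
    2 ≤ q.length := by
  by_contra! hq
  have h0 : q.length ≠ 0 := fun e => h.2.2.2.1 (Walk.eq_of_length_eq_zero e)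
  exact h.2.2.2.2.1 (q.adj_of_length_eq_one (by omega))

lemma IsShortJump.eq_or_eq_of_meet {p : G.Walk x y} (h : IsShortJump G w p) {a c : V}
    (ha : a ∈ p.support) (hc : c ∈ w.support) (hac : a = c ∨ G.Adj a c) :
    a = x ∨ a = y ∨ c = x ∨ c = y := by
  by_contra! hne
  have hi : a ∈ wInterior p := ⟨ha, hne.1, hne.2.1⟩
  rcases hac with rfl | hac
  · exact h.1.2.2.2.2.2.2 a hi hc
  · exact h.2 c hc hne.2.2.1 hne.2.2.2 a hi hac.symm

lemma IsShortJump.reverse {p : G.Walk x y} (h : IsShortJump G w p) :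
    IsShortJump G w p.reverse := by
  have hi : wInterior p.reverse = wInterior p := by
    ext a
    simp [wInterior, and_comm]
  obtain ⟨⟨h1, h2, h3, h4, h5, h6, h7⟩, h8⟩ := h
  exact ⟨⟨h1, h3, h2, h4.symm, fun e => h5 e.symm, h6.reverse, by rwa [hi]⟩, fun a ha n1 n2 =>
    hi ▸ h8 a ha n2 n1⟩

/-- Two vertices of a path cut it into three pieces. -/
lemma SimpleGraph.Walk.exists_append_append (p : G.Walk x y) {a b : V} (ha : a ∈ p.support)
    (hb : b ∈ p.support) :
    (∃ (r : G.Walk x a) (s : G.Walk a b) (t : G.Walk b y), p = r.append (s.append t)) ∨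
      ∃ (r : G.Walk x b) (s : G.Walk b a) (t : G.Walk a y), p = r.append (s.append t) := by
  classical
  rw [← p.take_spec ha, Walk.mem_support_append_iff] at hb
  rcases hb with hb | hb
  · refine .inr ⟨(p.takeUntil a ha).takeUntil b hb, (p.takeUntil a ha).dropUntil b hb,
      p.dropUntil a ha, ?_⟩
    rw [Walk.append_assoc, Walk.take_spec, Walk.take_spec]
  · refine .inl ⟨p.takeUntil a ha, (p.dropUntil a ha).takeUntil b hb,
      (p.dropUntil a ha).dropUntil b hb, ?_⟩
    rw [Walk.take_spec, Walk.take_spec]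

/-- In a shortest cycle, an arc is the only path between its ends avoiding an outer vertex. -/
lemma SimpleGraph.Walk.IsCycle.eq_of_edges_subset (hw : w.IsCycle)
    (hmin : ∀ (u : V) (c : G.Walk u u), c.IsCycle → w.length ≤ c.length) {p q : G.Walk x y}
    (hp : p.IsPath) (hq : q.IsPath) (hpw : p.edges ⊆ w.edges) (hqw : q.edges ⊆ w.edges) {a : V}
    (ha : a ∈ w.support) (hap : a ∉ p.support) (haq : a ∉ q.support) : p = q := by
  by_contra hne
  obtain ⟨s, t, p', q', hp', hq', hc⟩ := hp.exists_isCycle_of_ne hq hne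
  have hsub : (p'.append q'.reverse).edges ⊆ w.edges := by
    intro e he
    rw [Walk.edges_append, Walk.edges_reverse, List.mem_append, List.mem_reverse] at he
    exact he.elim (fun he => hpw (hp'.edges_subset he)) fun he => hqw (hq'.edges_subset he)
  have hperm := (hc.edges_nodup.subperm hsub).perm_of_length_le (by
    simpa only [Walk.length_edges] using hmin _ _ hc)
  rw [Walk.mem_support_iff_exists_mem_edges_of_not_nil hw.not_nil] at ha
  obtain ⟨e, he, hae⟩ := ha
  have he := hperm.mem_iff.2 he
  rw [Walk.edges_append, Walk.edges_reverse, List.mem_append, List.mem_reverse] at he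
  rcases he with he | he
  · exact hap (Walk.mem_support_of_mem_edges (hp'.edges_subset he) hae)
  · exact haq (Walk.mem_support_of_mem_edges (hq'.edges_subset he) hae)

end Arcs

section ShortJumps

variable {G : SimpleGraph V} {n : ℕ} {v u₁ v₁ u₂ v₂ : V} {w : G.Walk v v}

lemma hasOddK4_of_isShortJump (hn : ∀ (v : V) (c : G.Walk v v), c.IsCycle → n ≤ c.length)
    (hodd : ∀ (v : V) (c : G.Walk v v), IsOddHole G c → c.length = n) (hw : IsOddHole G w)
    {A P : G.Walk u₁ v₁} {B Q : G.Walk u₂ v₂} {X : G.Walk u₁ u₂} {Y : G.Walk v₂ v₁}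
    (hA : ArcsOf G w A (X.append (B.append Y))) (hP : IsShortJump G w P) (hQ : IsShortJump G w Q)
    (hu : u₁ ≠ u₂) (hv : v₁ ≠ v₂) (lP : P.length + A.length = n) (lQ : Q.length + B.length = n) :
    HasOddK4 G := by
  obtain ⟨hw, how⟩ := hw
  have lw := hodd _ _ ⟨hw, how⟩
  have iA := hA.isInducedPath hw hP.1.2.2.2.2.1
  have iZ := hA.symm.isInducedPath hw hP.1.2.2.2.2.1
  have iZ' := iZ
  rw [Walk.append_assoc] at iZ'
  have n2 : u₂ ≠ v₂ := hQ.1.2.2.2.1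
  have meetBX : ∀ a ∈ B.support, ∀ b ∈ X.support, a = b ∨ G.Adj a b → a = u₂ ∨ b = u₂ :=
    fun a ha b hb hab => (iZ.eq_or_eq_of_append hb
      ((Walk.mem_support_append_iff _ _).2 (.inl ha)) (by rwa [eq_comm, G.adj_comm])).symm
  have meetBY : ∀ a ∈ B.support, ∀ b ∈ Y.support, a = b ∨ G.Adj a b → a = v₂ ∨ b = v₂ :=
    fun a ha b hb hab => iZ.of_append_right.eq_or_eq_of_append ha hb hab
  have meetXY : ∀ a ∈ X.support, ∀ b ∈ Y.support, ¬ (a = b ∨ G.Adj a b) := by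
    intro a ha b hb hab
    have h1 := iZ.eq_or_eq_of_append ha ((Walk.mem_support_append_iff _ _).2 (.inr hb)) hab
    have h2 := iZ'.eq_or_eq_of_append ((Walk.mem_support_append_iff _ _).2 (.inl ha)) hb hab
    rcases h1 with rfl | rfl
    · rcases h2 with h2 | rfl
      · exact n2 h2
      · exact hab.elim n2 hQ.1.2.2.2.2.1
    · exact n2 (iZ'.1.eq_of_mem_append ((Walk.mem_support_append_iff _ _).2
        (.inl (Walk.end_mem_support _))) hb)
  have mX := X.start_mem_support
  have mY := Y.end_mem_support
  have hmem : ∀ c, c ∈ A.support ∨ c ∈ B.support ∨ c ∈ X.support ∨ c ∈ Y.support →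
      c ∈ w.support := by
    intro c hc
    rw [hA.mem_support_iff hw]
    simp only [Walk.mem_support_append_iff]
    rcases hc with hc | hc | hc | hc <;> simp [hc]
  have meet : ∀ a ∈ A.support, ∀ b, (b ∈ B.support ∨ b ∈ X.support ∨ b ∈ Y.support) →
      a = b ∨ G.Adj a b → (a = u₁ ∨ a = v₁) ∨ b = u₁ ∨ b = v₁ := by
    intro a ha b hb hab
    refine hA.eq_or_eq_of_meet hw ha ?_ hab
    simp only [Walk.mem_support_append_iff]
    rcases hb with hb | hb | hb <;> simp [hb]
  have hl := hA.length_add hw hP.1.2.2.2.2.1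
  refine UncrossedJumps.hasOddK4 (n := n) (A := A) (P := P) (B := B) (Q := Q) (X := X) (Y := Y)
    { le_length := hn
      length_le := fun u c hc => (hodd u c hc).le
      odd := lw ▸ how
      four_le := lw ▸ hw.2.1
      indA := iA
      indB := iZ.of_append_right.of_append_left
      indP := hP.1.2.2.2.2.2.1
      indQ := hQ.1.2.2.2.2.2.1
      indX := iZ.of_append_left
      indY := iZ.of_append_right.of_append_right
      meetAX := fun a ha b hb hab => ?_
      meetAY := fun a ha b hb hab => ?_
      meetBX := meetBX
      meetBY := meetBY
      meetXY := meetXY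
      meetAB := fun a ha b hb hab => ?_
      meetP := fun a ha c hc hac => hP.eq_or_eq_of_meet ha (hmem c hc) hac
      meetQ := fun a ha c hc hac => hQ.eq_or_eq_of_meet ha (hmem c hc) hac
      u₁_ne_v₁ := hP.1.2.2.2.1
      u₂_ne_v₂ := n2
      u₁_ne_u₂ := hu
      v₁_ne_v₂ := hv
      two_le_A := hP.1.two_le_length A
      two_le_B := hQ.1.two_le_length B
      length_cycle := by
        rw [Walk.length_append, Walk.length_append] at hl
        omega
      length_P := lP
      length_Q := lQ }
  · rcases meet a ha b (.inr (.inl hb)) hab with (h1 | rfl) | h1 | rfl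
    · exact .inl h1
    · exact (meetXY b hb _ mY (by rwa [eq_comm, G.adj_comm])).elim
    · exact .inr h1
    · exact (meetXY _ hb _ mY (.inl rfl)).elim
  · rcases meet a ha b (.inr (.inr hb)) hab with (rfl | h1) | rfl | h1
    · exact (meetXY _ mX b hb hab).elim
    · exact .inl h1
    · exact (meetXY _ mX _ hb (.inl rfl)).elim
    · exact .inr h1
  · rcases meet a ha b (.inl hb) hab with (rfl | rfl) | rfl | rfl
    · exact .inl ⟨rfl, (meetBX b hb _ mX (by rwa [eq_comm, G.adj_comm])).resolve_right hu⟩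
    · exact .inr ⟨rfl, (meetBY b hb _ mY (by rwa [eq_comm, G.adj_comm])).resolve_right hv⟩
    · exact ((meetBX _ hb _ mX (.inl rfl)).elim hu hu).elim
    · exact ((meetBY _ hb _ mY (.inl rfl)).elim hv hv).elim

lemma hasOddK4_of_isShortJumpAcross
    (hn : ∀ (v : V) (c : G.Walk v v), c.IsCycle → n ≤ c.length)
    (hodd : ∀ (v : V) (c : G.Walk v v), IsOddHole G c → c.length = n) (hw : IsOddHole G w)
    {P A D : G.Walk u₁ v₁} {Q B E : G.Walk u₂ v₂} (hP : IsShortJumpAcross G w P A D)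
    (hQ : IsShortJumpAcross G w Q B E) (hd : [u₁, u₂, v₂, v₁].Nodup)
    (hA : u₂ ∉ wInterior A ∧ v₂ ∉ wInterior A) (hB : u₁ ∉ wInterior B ∧ v₁ ∉ wInterior B) :
    HasOddK4 G := by
  obtain ⟨jP, aP, oP⟩ := hP
  obtain ⟨jQ, aQ, oQ⟩ := hQ
  have lP := hodd _ _ oP
  have lQ := hodd _ _ oQ
  rw [Walk.length_append, Walk.length_reverse] at lP lQ
  have lw := hodd _ _ hw
  simp only [List.nodup_cons, List.mem_cons, List.not_mem_nil, or_false, not_or] at hd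
  obtain ⟨⟨n1, n2, -⟩, ⟨-, n3⟩, n4, -⟩ := hd
  have hu : u₂ ∈ D.support := ((aP.mem_support_iff hw.1).1 aQ.1).resolve_left fun hu =>
    hA.1 ⟨hu, Ne.symm n1, n3⟩
  have hv : v₂ ∈ D.support := ((aP.mem_support_iff hw.1).1 aQ.2.1).resolve_left fun hv =>
    hA.2 ⟨hv, Ne.symm n2, n4⟩
  have huB : u₁ ∉ B.support := fun hu => hB.1 ⟨hu, n1, n2⟩
  have hD : D.edges ⊆ w.edges := fun e he => aP.mem_edges_iff.2 (.inr he)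
  have hBw : B.edges ⊆ w.edges := fun e he => aQ.mem_edges_iff.2 (.inl he)
  rcases D.exists_append_append hu hv with ⟨X, B', Y, rfl⟩ | ⟨X, B', Y, rfl⟩
  · obtain rfl : B' = B := by
      refine hw.1.1.eq_of_edges_subset (by rwa [lw]) aP.2.2.2.2.1.of_append_right.of_append_left
        aQ.2.2.2.1 (fun e he => hD (by simp [he])) hBw aP.1 (fun hu' => ?_) huB
      exact n1 (aP.2.2.2.2.1.eq_of_mem_append X.start_mem_support
        ((Walk.mem_support_append_iff _ _).2 (.inl hu')))
    exact hasOddK4_of_isShortJump hn hodd hw aP jP jQ n1 (Ne.symm n4) lP lQ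
  · obtain rfl : B' = B.reverse := by
      refine hw.1.1.eq_of_edges_subset (by rwa [lw]) aP.2.2.2.2.1.of_append_right.of_append_left
        aQ.2.2.2.1.reverse (fun e he => hD (by simp [he])) (by simpa using hBw) aP.1
        (fun hu' => ?_) (by simpa using huB)
      exact n2 (aP.2.2.2.2.1.eq_of_mem_append X.start_mem_support
        ((Walk.mem_support_append_iff _ _).2 (.inl hu')))
    exact hasOddK4_of_isShortJump hn hodd hw aP jP jQ.reverse n2 (Ne.symm n3) lP (by simpa using lQ)

end ShortJumps

/-- Two uncrossing short jumps (`P1` across `C*(v1,u1)`, `P2`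
across `C*(u2,v2)`, where `u1, u2, v2, v1` appear on `C` in clockwise order)
yield an odd `K4`-subdivision. -/
theorem uncrossing_short_jumps_give_odd_K4 {V : Type*} [Fintype V]
    (l : ℕ) (hl : 4 ≤ l) (G : SimpleGraph V) (hG : MemGFam G l)
    {v u1 v1 u2 v2 : V} (w : G.Walk v v) (hw : IsOddHole G w)
    (P1 A1 B1 : G.Walk u1 v1) (P2 A2 B2 : G.Walk u2 v2)
    (hne : ({u1, v1} : Set V) ≠ {u2, v2})
    (horder : CyclicOrder4 G w u1 u2 v2 v1)
    (hA1 : u2 ∉ wInterior A1 ∧ v2 ∉ wInterior A1)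
    (hA2 : u1 ∉ wInterior A2 ∧ v1 ∉ wInterior A2)
    (h1 : IsShortJumpAcross G w P1 A1 B1)
    (h2 : IsShortJumpAcross G w P2 A2 B2) :
    HasOddK4 G := by
  have hn : ∀ (v : V) (c : G.Walk v v), c.IsCycle → 2 * l + 1 ≤ c.length := fun v c hc => by
    rw [← Nat.cast_id (2 * l + 1), ← hG.1]
    exact ENat.toNat_le_of_le_natCast (SimpleGraph.egirth_le_length hc)
  refine hasOddK4_of_isShortJumpAcross hn (fun v c hc => ?_) hw h1 h2 ?_ hA1 hA2
  · have := hn v c hc.1.1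
    have := hG.2 v c hc
    obtain ⟨m, hm⟩ := hc.2
    omega
  · obtain ⟨m, hm⟩ := horder
    exact hm.nodup (List.nodup_rotate.2 hw.1.1.support_nodup)
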